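/- arXiv:2002.08216 — 2 statements merged into one kernel-verified Lean document; each statement's English description precedes it below -/
import Mathlib

section
/- Let Σ be a finite alphabet, Δ ≥ 1 an integer, B a collection of multisets of Δ labels over Σ, and K, L ∈ Σ such that L is at least as strong as K according to B. Let C be a multiset of Δ subsets of Σ that is universally closed and maximal for B. Then every subset F occurring in C that contains K also contains L. -/
/-- `L` is at least as strong as `K` according to the collection `B`: replacing
one copy of `K` by `L` in any member of `B` containing `K` yields a member of `B`. -/
def atLeastAsStrong {σ : Type*} [DecidableEq σ] (B : Multiset σ → Prop) (K L : σ) : Prop :=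
  ∀ w : Multiset σ, B w → K ∈ w → B (L ::ₘ w.erase K)

/-- `C` is universally closed for the collection `B`: every multiset obtained by
choosing one label from each subset in `C` belongs to `B`. -/
def universallyClosed {σ : Type*} (B : Multiset σ → Prop) (C : Multiset (Finset σ)) : Prop :=
  ∀ w : Multiset σ, Multiset.Rel (fun l F => l ∈ F) w C → B w

/-- `C` is maximal for `B`: enlarging one copy of a subset occurring in `C` by a new label
always destroys universal closedness. -/
def maximalFor {σ : Type*} [DecidableEq σ] (B : Multiset σ → Prop)
    (C : Multiset (Finset σ)) : Prop :=
  ∀ F ∈ C, ∀ l ∉ F, ¬ universallyClosed B (insert l F ::ₘ C.erase F)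

theorem stmt6 {σ : Type*} [Fintype σ] [DecidableEq σ] (Δ : ℕ) (hΔ : 1 ≤ Δ)
    (B : Multiset σ → Prop) (K L : σ)
    (hstrong : atLeastAsStrong B K L)
    (C : Multiset (Finset σ)) (hcard : Multiset.card C = Δ)
    (hclosed : universallyClosed B C) (hmax : maximalFor B C) :
    ∀ F ∈ C, K ∈ F → L ∈ F := by
  intro F hF hK
  by_contra hL
  refine hmax F hF L hL fun w hw => ?_
  obtain ⟨a, w', ha, hw', rfl⟩ := Multiset.rel_cons_right.1 hw
  have hchoice : ∀ b ∈ F, B (b ::ₘ w') := fun b hb =>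
    hclosed _ (Multiset.cons_erase hF ▸ Multiset.rel_cons_right.2 ⟨b, w', hb, hw', rfl⟩)
  rcases Finset.mem_insert.1 ha with rfl | ha
  · simpa using hstrong _ (hchoice K hK) (Multiset.mem_cons_self K w')
  · exact hchoice a ha
end

section
/- Let Δ ≥ 2 be an integer, K ≥ 1 a real number, and p a real number with 0 ≤ p ≤ 1. Let (p_j)_{j≥0} be a sequence of nonnegative real numbers such that p_0 ≤ p and p_{j+1} ≤ K·Δ·p_j^{1/(Δ+1)} for every j ≥ 0. Then for every j ≥ 0 it holds that p_j ≤ (K·Δ)^2 · p^{1/(Δ+1)^j}. -/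
theorem stmt9 (Δ : ℕ) (hΔ : 2 ≤ Δ) (K : ℝ) (hK : 1 ≤ K)
    (p : ℝ) (hp0 : 0 ≤ p) (hp1 : p ≤ 1)
    (q : ℕ → ℝ) (hq : ∀ j, 0 ≤ q j) (hq0 : q 0 ≤ p)
    (hrec : ∀ j, q (j + 1) ≤ K * Δ * (q j) ^ ((1 : ℝ) / ((Δ : ℝ) + 1))) :
    ∀ j, q j ≤ (K * Δ) ^ 2 * p ^ ((1 : ℝ) / ((Δ : ℝ) + 1) ^ j) := by
  have hΔ' : (2 : ℝ) ≤ Δ := by exact_mod_cast hΔ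
  have hC : 1 ≤ K * Δ := by nlinarith
  have hC0 : 0 ≤ K * Δ := zero_le_one.trans hC
  set s : ℝ := 1 / ((Δ : ℝ) + 1) with hs
  have hs0 : 0 ≤ s := by positivity
  have hs_half : s ≤ 1 / 2 := by
    rw [hs]
    gcongr
    linarith
  have hCs : ((K * Δ) ^ 2) ^ s ≤ K * Δ := by
    calc ((K * Δ) ^ 2) ^ s = (K * Δ) ^ (2 * s) := by
          rw [Real.rpow_mul hC0, Real.rpow_two]
      _ ≤ (K * Δ) ^ (1 : ℝ) := Real.rpow_le_rpow_of_exponent_le hC (by linarith)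
      _ = K * Δ := Real.rpow_one _
  intro j
  induction j with
  | zero =>
    rw [pow_zero, div_one, Real.rpow_one]
    exact hq0.trans (le_mul_of_one_le_left hp0 (one_le_pow₀ hC))
  | succ j ih =>
    calc q (j + 1) ≤ K * Δ * q j ^ s := hrec j
      _ ≤ K * Δ * ((K * Δ) ^ 2 * p ^ ((1 : ℝ) / ((Δ : ℝ) + 1) ^ j)) ^ s := by
          gcongr
          exact hq j
      _ = K * Δ * (((K * Δ) ^ 2) ^ s * p ^ ((1 : ℝ) / ((Δ : ℝ) + 1) ^ (j + 1))) := by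
          rw [Real.mul_rpow (by positivity) (by positivity), ← Real.rpow_mul hp0, hs,
            div_mul_div_comm, one_mul, ← pow_succ]
      _ ≤ K * Δ * (K * Δ * p ^ ((1 : ℝ) / ((Δ : ℝ) + 1) ^ (j + 1))) := by gcongr
      _ = (K * Δ) ^ 2 * p ^ ((1 : ℝ) / ((Δ : ℝ) + 1) ^ (j + 1)) := by ring
end
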